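/- (Theorem 2.1, direct part) In the general hypothesis testing setup, for every r > 0, every real number E with E < inf{ R + η(R) : R ∈ ℝ, η(R) < r } is r-achievable; that is, there exist measurable acceptance regions A_n ⊆ Ω_n such that liminf_{n→∞} −(1/n) log μ_n ≥ r and liminf_{n→∞} −(1/n) log λ_n ≥ E. -/

import Mathlib

open MeasureTheory Filter
open scoped ENNReal NNReal

/-- The exponent `-(1/n) log p` of a nonneg extended real `p`, valued in `EReal`,
with the conventions `-log 0 = +∞` and `-log ∞ = -∞`. -/
noncomputable def expRate (n : ℕ) (p : ℝ≥0∞) : EReal :=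
  (((n : ℝ)⁻¹ : ℝ) : EReal) * (-(ENNReal.log p))

/-- The likelihood ratio `dμ/dν`, defined to be `+∞` on the part of the space where
`μ` is singular with respect to `ν` (μ-a.e.). -/
noncomputable def lratio {Ω : Type*} [MeasurableSpace Ω] (μ ν : Measure Ω) (x : Ω) : ℝ≥0∞ :=
  μ.rnDeriv (μ + ν) x / ν.rnDeriv (μ + ν) x

section Setup

variable {Ω : ℕ → Type*} [∀ n, MeasurableSpace (Ω n)]

/-- `η(R) = liminf_n -(1/n) log P_n{ (1/n) log dP_n/dQ_n ≤ R }`. -/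
noncomputable def eta (P Q : ∀ n, Measure (Ω n)) (R : ℝ) : EReal :=
  Filter.atTop.liminf fun n =>
    expRate n ((P n) {x | lratio (P n) (Q n) x ≤ ENNReal.ofReal (Real.exp (n * R))})

/-- `E` is `r`-achievable: there are measurable acceptance regions `A n` with
`liminf -(1/n) log μ_n ≥ r` and `liminf -(1/n) log λ_n ≥ E`. -/
def rAchievable (P Q : ∀ n, Measure (Ω n)) (r E : ℝ) : Prop :=
  ∃ A : ∀ n, Set (Ω n), (∀ n, MeasurableSet (A n)) ∧
    (r : EReal) ≤ Filter.atTop.liminf (fun n => expRate n ((P n) (A n)ᶜ)) ∧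
    (E : EReal) ≤ Filter.atTop.liminf (fun n => expRate n ((Q n) (A n)))

/-- The optimal error exponent `B_e(r)`: the supremum of all `r`-achievable `E`. -/
noncomputable def Be (P Q : ∀ n, Measure (Ω n)) (r : ℝ) : EReal :=
  sSup {x : EReal | ∃ E : ℝ, rAchievable P Q r E ∧ x = (E : EReal)}

end Setup

lemma le_expRate_iff {n : ℕ} (hn : 0 < n) (a : ℝ) (p : ℝ≥0∞) :
    (a : EReal) ≤ expRate n p ↔ p ≤ ENNReal.ofReal (Real.exp (-(n * a))) := by
  have hn' : (0 : ℝ) < n := by exact_mod_cast hn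
  have hinv : (0 : ℝ) < (n : ℝ)⁻¹ := inv_pos.2 hn'
  unfold expRate
  by_cases h0 : p = 0
  · simp [h0, EReal.coe_mul_top_of_pos hinv]
  by_cases ht : p = ⊤
  · simp [ht, EReal.coe_mul_bot_of_pos hinv]
  have hp : 0 < p.toReal := ENNReal.toReal_pos h0 ht
  rw [ENNReal.log_pos_real h0 ht, ENNReal.le_ofReal_iff_toReal_le ht (Real.exp_pos _).le,
    ← Real.log_le_iff_le_exp hp, ← EReal.coe_neg, ← EReal.coe_mul, EReal.coe_le_coe_iff,
    le_inv_mul_iff₀ hn']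
  constructor <;> intro h <;> linarith

lemma eventually_of_lt_liminf {p : ℕ → ℝ≥0∞} {a : ℝ}
    (h : (a : EReal) < atTop.liminf (fun n => expRate n (p n))) :
    ∀ᶠ n in atTop, p n ≤ ENNReal.ofReal (Real.exp (-(n * a))) := by
  filter_upwards [eventually_lt_of_lt_liminf h, eventually_gt_atTop 0] with n h1 h2
  exact (le_expRate_iff h2 a _).1 h1.le

lemma le_liminf_of_eventually {p : ℕ → ℝ≥0∞} {E : ℝ}
    (h : ∀ a : ℝ, a < E → ∀ᶠ n in atTop, p n ≤ ENNReal.ofReal (Real.exp (-(n * a)))) :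
    (E : EReal) ≤ atTop.liminf (fun n => expRate n (p n)) := by
  refine le_of_forall_lt fun c hc => ?_
  obtain ⟨a, hca, haE⟩ := EReal.lt_iff_exists_real_btwn.1 hc
  refine hca.trans_le (le_liminf_of_le (h := ?_))
  filter_upwards [h a (by exact_mod_cast haE), eventually_gt_atTop 0] with n h1 h2
  exact (le_expRate_iff h2 a _).2 h1

lemma measurable_lratio {Ω : Type*} [MeasurableSpace Ω] (μ ν : Measure Ω) :
    Measurable (lratio μ ν) :=
  (Measure.measurable_rnDeriv _ _).div (Measure.measurable_rnDeriv _ _)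

lemma mul_measure_le {Ω : Type*} [MeasurableSpace Ω] (μ ν : Measure Ω) [IsProbabilityMeasure μ]
    [IsProbabilityMeasure ν] (c : ℝ≥0∞) {B : Set Ω} (hB : MeasurableSet B)
    (h : ∀ x ∈ B, c < lratio μ ν x) : c * ν B ≤ μ B := by
  have h1 : μ ≪ μ + ν := Measure.AbsolutelyContinuous.rfl.add_right ν
  have h2 : ν ≪ μ + ν := by
    rw [add_comm]; exact Measure.AbsolutelyContinuous.rfl.add_right μ
  rw [← Measure.setLIntegral_rnDeriv h1 B, ← Measure.setLIntegral_rnDeriv h2 B,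
    ← lintegral_const_mul _ (Measure.measurable_rnDeriv _ _)]
  refine setLIntegral_mono' hB fun x hx => ?_
  exact ENNReal.mul_le_of_le_div (h x hx).le

lemma measure_le_exp {Ω : Type*} [MeasurableSpace Ω] (μ ν : Measure Ω) [IsProbabilityMeasure μ]
    [IsProbabilityMeasure ν] (t : ℝ) {B : Set Ω} (hB : MeasurableSet B)
    (h : ∀ x ∈ B, ENNReal.ofReal (Real.exp t) < lratio μ ν x) :
    ν B ≤ ENNReal.ofReal (Real.exp (-t)) * μ B := by
  have h1 := mul_measure_le μ ν _ hB h
  calc ν B = ENNReal.ofReal (Real.exp (-t)) * (ENNReal.ofReal (Real.exp t) * ν B) := by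
        rw [← mul_assoc, ← ENNReal.ofReal_mul (Real.exp_pos _).le, ← Real.exp_add]; simp
    _ ≤ _ := by gcongr

/-- Theorem 2.1, direct part: for `r > 0`, every real
`E < inf { R + η(R) : R ∈ ℝ, η(R) < r }` is `r`-achievable. -/
theorem han_theorem_2_1_direct {Ω : ℕ → Type*} [∀ n, MeasurableSpace (Ω n)]
    (P Q : ∀ n, Measure (Ω n)) [∀ n, IsProbabilityMeasure (P n)]
    [∀ n, IsProbabilityMeasure (Q n)] (r : ℝ) (hr : 0 < r) (E : ℝ)
    (hE : (E : EReal) <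
      sInf {x : EReal | ∃ R : ℝ, eta P Q R < (r : EReal) ∧ x = (R : EReal) + eta P Q R}) :
    rAchievable P Q r E := by
  classical
  obtain ⟨E', hEE', hE'⟩ := EReal.lt_iff_exists_real_btwn.1 hE
  have hEE'r : E < E' := by exact_mod_cast hEE'
  set δ := E' - E with hδ
  have hδ0 : 0 < δ := by linarith
  have key : ∀ R : ℝ, eta P Q R < (r : EReal) → ((E' - R : ℝ) : EReal) < eta P Q R := by
    intro R hR
    have h1 : (E' : EReal) < (R : EReal) + eta P Q R := hE'.trans_le (sInf_le ⟨R, hR, rfl⟩)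
    revert h1 hR
    generalize eta P Q R = y
    induction y with
    | bot => simp
    | top => simp
    | coe y =>
      intro _ h1
      have h2 : E' < R + y := by exact_mod_cast h1
      exact_mod_cast (by linarith : E' - R < y)
  set D : ℝ → ∀ n, Set (Ω n) := fun R n =>
    {x | ENNReal.ofReal (Real.exp (n * R)) < lratio (P n) (Q n) x} with hD
  have hDm : ∀ R n, MeasurableSet (D R n) := fun R n =>
    measurableSet_lt measurable_const (measurable_lratio _ _)
  have hDc : ∀ R n, (D R n)ᶜ =
      {x | lratio (P n) (Q n) x ≤ ENNReal.ofReal (Real.exp (n * R))} := by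
    intro R n; ext x; simp [hD]
  have hGood : ∀ m : ℕ, rAchievable P Q r E ∨ ∀ a : ℝ, a < E →
      ∀ᶠ n in atTop, (Q n) (D (E - m * δ) n) ≤ ENNReal.ofReal (Real.exp (-(n * a))) := by
    have done : ∀ R : ℝ, (r : EReal) ≤ eta P Q R → (∀ a : ℝ, a < E →
        ∀ᶠ n in atTop, (Q n) (D R n) ≤ ENNReal.ofReal (Real.exp (-(n * a)))) →
        rAchievable P Q r E := by
      intro R hR h
      refine ⟨D R, hDm R, ?_, le_liminf_of_eventually h⟩
      simp only [hDc]
      exact hR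
    intro m
    induction m with
    | zero =>
      right
      intro a ha
      refine Eventually.of_forall fun n => ?_
      have h1 := measure_le_exp (P n) (Q n) (n * E) (hDm E n) (fun x hx => hx)
      simp only [Nat.cast_zero, zero_mul, sub_zero]
      refine h1.trans ((mul_le_of_le_one_right' prob_le_one).trans ?_)
      gcongr
    | succ m ih =>
      rcases ih with ih | ih
      · exact Or.inl ih
      set R := E - m * δ with hR
      have hR' : E - ((m + 1 : ℕ) : ℝ) * δ = R - δ := by push_cast; ring
      rw [hR']
      by_cases hη : eta P Q R < (r : EReal)
      · right
        intro a ha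
        obtain ⟨b, hab, hbE⟩ := exists_between ha
        have hlt : ((b - (R - δ) : ℝ) : EReal) < eta P Q R :=
          lt_of_le_of_lt (by exact_mod_cast (by linarith : b - (R - δ) ≤ E' - R)) (key R hη)
        have hlog : ∀ᶠ n : ℕ in atTop, Real.log 2 ≤ n * (b - a) :=
          (tendsto_natCast_atTop_atTop.atTop_mul_const (by linarith : (0 : ℝ) < b - a)).eventually_ge_atTop _
        filter_upwards [ih b hbE, eventually_of_lt_liminf hlt, hlog] with n h1 h2 h3
        have hsub : D (R - δ) n ⊆ D R n ∪ (D (R - δ) n ∩ (D R n)ᶜ) := by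
          intro x hx
          by_cases hx' : x ∈ D R n
          · exact Or.inl hx'
          · exact Or.inr ⟨hx, hx'⟩
        have h4 : (Q n) (D (R - δ) n ∩ (D R n)ᶜ) ≤ ENNReal.ofReal (Real.exp (-(n * b))) := by
          refine (measure_le_exp (P n) (Q n) (n * (R - δ)) ((hDm _ n).inter (hDm _ n).compl)
            (fun x hx => hx.1)).trans ?_
          calc _ ≤ ENNReal.ofReal (Real.exp (-(n * (R - δ)))) *
                ENNReal.ofReal (Real.exp (-(n * (b - (R - δ))))) := by
                gcongr
                refine (measure_mono Set.inter_subset_right).trans ?_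
                rw [hDc]; exact h2
            _ = _ := by
                rw [← ENNReal.ofReal_mul (Real.exp_pos _).le, ← Real.exp_add]
                congr 2; ring
        calc (Q n) (D (R - δ) n) ≤ _ := measure_mono hsub
          _ ≤ _ := measure_union_le _ _
          _ ≤ _ := add_le_add h1 h4
          _ = ENNReal.ofReal (Real.exp (Real.log 2 + -(n * b))) := by
              rw [← ENNReal.ofReal_add (Real.exp_pos _).le (Real.exp_pos _).le, Real.exp_add,
                Real.exp_log two_pos, two_mul]
          _ ≤ _ := by
              gcongr
              linarith
      · exact Or.inl (done R (not_lt.1 hη) ih)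
  obtain ⟨m, hm⟩ := exists_nat_gt (r / δ)
  have hm' : r < m * δ := (div_lt_iff₀ hδ0).1 hm
  rcases hGood m with h | h
  · exact h
  · refine ⟨D (E - m * δ), hDm _, ?_, le_liminf_of_eventually h⟩
    simp only [hDc]
    by_contra hlt
    have hlt' : eta P Q (E - m * δ) < (r : EReal) := not_le.1 hlt
    have h2 := (key _ hlt').trans hlt'
    have h3 : E' - (E - m * δ) < r := by exact_mod_cast h2
    linarith
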